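/- Let j, k, n be positive integers with j < n and j < k, and let p₀,…,p_k ∈ ℝ^{1,n} be (k+1) points such that dim V(p₀,…,p_j) = dim V(p₀,…,p_k) = j. Then the Lorentzian distance-squared mapping L_{(p₀,…,p_k)} : ℝ^{1,n} → ℝ^{k+1} is A-equivalent to τ ∘ Φ_j if and only if the recognition subspace V(p₀,…,p_k) is time-like, where τ : ℝ^{j+1} → ℝ^{k+1} is the inclusion τ(X₀,…,X_j) = (X₀,…,X_j, 0,…,0). -/

import Mathlib

open scoped BigOperators

noncomputable section

/-- The Lorentzian inner product on `ℝ^{1,n}`, modeled as `Fin (n+1) → ℝ`: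
`⟨x,y⟩ = -x₀y₀ + x₁y₁ + ⋯ + xₙyₙ`. -/
def lorIP {n : ℕ} (x y : Fin (n + 1) → ℝ) : ℝ :=
  (∑ i, x i * y i) - 2 * (x 0 * y 0)

/-- The Euclidean inner product on `Fin m → ℝ`. -/
def eucIP {m : ℕ} (x y : Fin m → ℝ) : ℝ := ∑ i, x i * y i

/-- The Lorentzian distance-squared mapping determined by the points `p 0, …, p (m-1)`. -/
def LorDSM {n m : ℕ} (p : Fin m → Fin (n + 1) → ℝ) :
    (Fin (n + 1) → ℝ) → (Fin m → ℝ) :=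
  fun x i => lorIP (x - p i) (x - p i)

/-- The Euclidean distance-squared mapping determined by the points `p 0, …, p (m-1)`. -/
def EucDSM {n m : ℕ} (p : Fin m → Fin (n + 1) → ℝ) :
    (Fin (n + 1) → ℝ) → (Fin m → ℝ) :=
  fun x i => eucIP (x - p i) (x - p i)

/-- The recognition subspace `V(p₀, …, p_k)`: the span of the vectors `p i - p 0`. -/
def recSub {n k : ℕ} (p : Fin (k + 1) → Fin (n + 1) → ℝ) :
    Submodule ℝ (Fin (n + 1) → ℝ) :=
  Submodule.span ℝ (Set.range fun i => p i - p 0)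

/-- The partial recognition subspace `V(p₀, …, p_j)`: the span of `p i - p 0` for `i ≤ j`. -/
def recSubUpTo {n k : ℕ} (p : Fin (k + 1) → Fin (n + 1) → ℝ) (j : ℕ) :
    Submodule ℝ (Fin (n + 1) → ℝ) :=
  Submodule.span ℝ {v | ∃ i : Fin (k + 1), (i : ℕ) ≤ j ∧ v = p i - p 0}

/-- A subspace is time-like iff it contains a vector of negative Lorentzian square. -/
def LTimeLike {n : ℕ} (V : Submodule ℝ (Fin (n + 1) → ℝ)) : Prop :=
  ∃ v ∈ V, lorIP v v < 0

/-- A subspace is space-like iff every nonzero vector in it has positive Lorentzian square. -/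
def LSpaceLike {n : ℕ} (V : Submodule ℝ (Fin (n + 1) → ℝ)) : Prop :=
  ∀ v ∈ V, v ≠ 0 → 0 < lorIP v v

/-- A subspace is light-like iff it is neither time-like nor space-like. -/
def LLightLike {n : ℕ} (V : Submodule ℝ (Fin (n + 1) → ℝ)) : Prop :=
  ¬ LTimeLike V ∧ ¬ LSpaceLike V

/-- `f` and `g` are `𝒜`-equivalent: `g = H ∘ f ∘ h` for `C^∞` diffeomorphisms `h, H`. -/
def AEquiv {a b : ℕ} (f g : (Fin a → ℝ) → (Fin b → ℝ)) : Prop :=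
  ∃ (h : (Fin a → ℝ) ≃ (Fin a → ℝ)) (H : (Fin b → ℝ) ≃ (Fin b → ℝ)),
    ContDiff ℝ (⊤ : ℕ∞) ⇑h ∧ ContDiff ℝ (⊤ : ℕ∞) ⇑h.symm ∧
    ContDiff ℝ (⊤ : ℕ∞) ⇑H ∧ ContDiff ℝ (⊤ : ℕ∞) ⇑H.symm ∧
    g = ⇑H ∘ f ∘ ⇑h

/-- The Lorentzian inner product as a bilinear form. -/
def lorForm (n : ℕ) : LinearMap.BilinForm ℝ (Fin (n + 1) → ℝ) :=
  LinearMap.mk₂ ℝ lorIP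
    (fun x y z => by simp only [lorIP, Pi.add_apply, add_mul, Finset.sum_add_distrib]; ring)
    (fun c x y => by
      simp only [lorIP, Pi.smul_apply, smul_eq_mul, mul_assoc, ← Finset.mul_sum]; ring)
    (fun x y z => by simp only [lorIP, Pi.add_apply, mul_add, Finset.sum_add_distrib]; ring)
    (fun c x y => by
      simp only [lorIP, Pi.smul_apply, smul_eq_mul, mul_left_comm _ c, ← Finset.mul_sum]; ring)

@[simp]
lemma lorForm_apply {n : ℕ} (x y : Fin (n + 1) → ℝ) : lorForm n x y = lorIP x y := rfl

lemma lorIP_eq {n : ℕ} (x y : Fin (n + 1) → ℝ) :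
    lorIP x y = (∑ i : Fin n, x i.succ * y i.succ) - x 0 * y 0 := by
  simp only [lorIP, Fin.sum_univ_succ]
  ring

lemma lorIP_comm {n : ℕ} (x y : Fin (n + 1) → ℝ) : lorIP x y = lorIP y x := by
  simp only [lorIP, mul_comm]

lemma lorIP_add_left {n : ℕ} (x y z : Fin (n + 1) → ℝ) :
    lorIP (x + y) z = lorIP x z + lorIP y z :=
  (lorForm n).map_add₂ x y z

lemma lorIP_add_right {n : ℕ} (x y z : Fin (n + 1) → ℝ) :
    lorIP x (y + z) = lorIP x y + lorIP x z :=
  (lorForm n x).map_add y z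

lemma lorIP_smul_left {n : ℕ} (c : ℝ) (x y : Fin (n + 1) → ℝ) :
    lorIP (c • x) y = c * lorIP x y :=
  (lorForm n).map_smul₂ c x y

lemma lorIP_smul_right {n : ℕ} (c : ℝ) (x y : Fin (n + 1) → ℝ) :
    lorIP x (c • y) = c * lorIP x y :=
  (lorForm n x).map_smul c y

lemma lorIP_sub_left {n : ℕ} (x y z : Fin (n + 1) → ℝ) :
    lorIP (x - y) z = lorIP x z - lorIP y z :=
  (lorForm n).map_sub₂ x y z

lemma lorIP_sub_right {n : ℕ} (x y z : Fin (n + 1) → ℝ) :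
    lorIP x (y - z) = lorIP x y - lorIP x z :=
  (lorForm n x).map_sub y z

lemma lorIP_zero_right {n : ℕ} (x : Fin (n + 1) → ℝ) : lorIP x 0 = 0 :=
  (lorForm n x).map_zero

lemma lorIP_sum_right {n : ℕ} {ι : Type*} (s : Finset ι) (x : Fin (n + 1) → ℝ)
    (f : ι → Fin (n + 1) → ℝ) : lorIP x (∑ i ∈ s, f i) = ∑ i ∈ s, lorIP x (f i) :=
  map_sum (lorForm n x) f s

lemma lorForm_isSymm (n : ℕ) : (lorForm n).IsSymm :=
  ⟨fun x y => lorIP_comm x y⟩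

lemma eq_zero_of_lorIP_eq_zero {n : ℕ} {x : Fin (n + 1) → ℝ} (hx : ∀ y, lorIP x y = 0) :
    x = 0 := by
  have h0 : x 0 = 0 := by
    simpa [lorIP_eq, Pi.single_apply] using hx (Pi.single 0 1)
  funext i
  have hi := hx (Pi.single i 1)
  simpa [lorIP, Pi.single_apply, h0] using hi

lemma lorForm_nondegenerate (n : ℕ) : (lorForm n).Nondegenerate :=
  ⟨fun _ hx => eq_zero_of_lorIP_eq_zero hx,
    fun x hx => eq_zero_of_lorIP_eq_zero fun y => (lorIP_comm x y).trans (hx y)⟩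

/-- The Lorentzian orthogonal complement of a subspace. -/
def lorPerp {n : ℕ} (V : Submodule ℝ (Fin (n + 1) → ℝ)) : Submodule ℝ (Fin (n + 1) → ℝ) :=
  (lorForm n).orthogonal V

lemma mem_lorPerp {n : ℕ} {V : Submodule ℝ (Fin (n + 1) → ℝ)} {x : Fin (n + 1) → ℝ} :
    x ∈ lorPerp V ↔ ∀ v ∈ V, lorIP x v = 0 :=
  forall₂_congr fun v _ => by
    rw [lorIP_comm]
    exact Iff.rfl

lemma finrank_lorPerp {n : ℕ} (V : Submodule ℝ (Fin (n + 1) → ℝ)) :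
    Module.finrank ℝ (lorPerp V) = n + 1 - Module.finrank ℝ V := by
  have h := LinearMap.BilinForm.finrank_orthogonal (lorForm_nondegenerate n) V
  rwa [Module.finrank_fin_fun] at h

/-- A nonzero vector orthogonal to a time-like vector is space-like. -/
lemma lorIP_self_pos_of_orthogonal {n : ℕ} {v w : Fin (n + 1) → ℝ} (hv : lorIP v v < 0)
    (hvw : lorIP w v = 0) (hw : w ≠ 0) : 0 < lorIP w w := by
  rw [lorIP_eq] at *
  have hcs := Finset.sum_mul_sq_le_sq_mul_sq Finset.univ
    (fun i : Fin n => w i.succ) (fun i : Fin n => v i.succ)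
  simp only [pow_two (w _), pow_two (v _)] at hcs
  rw [sub_eq_zero.mp hvw] at hcs
  have hA : 0 ≤ ∑ i : Fin n, w i.succ * w i.succ :=
    Finset.sum_nonneg fun i _ => mul_self_nonneg _
  have hB : 0 ≤ ∑ i : Fin n, v i.succ * v i.succ :=
    Finset.sum_nonneg fun i _ => mul_self_nonneg _
  rcases hA.eq_or_lt with h | h
  · have hsucc : ∀ i : Fin n, w i.succ = 0 := fun i => by
      have := (Finset.sum_eq_zero_iff_of_nonneg fun i _ => mul_self_nonneg (w (Fin.succ i))).mp
        h.symm i (Finset.mem_univ i)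
      simpa using this
    have h0 : w 0 = 0 := by
      have hv0 : v 0 ≠ 0 := by
        rintro h0
        rw [h0] at hv
        linarith
      simpa [hsucc, hv0] using hvw
    exact absurd (funext fun i => Fin.cases h0 hsucc i) hw
  · generalize ∑ i : Fin n, w i.succ * w i.succ = a at *
    generalize ∑ i : Fin n, v i.succ * v i.succ = b at *
    nlinarith [mul_self_nonneg (w 0), mul_pos h (sub_pos.mpr (sub_neg.mp hv))]

/-- A Lorentzian subspace of dimension at least two without nonzero null vectors is space-like. -/
lemma LSpaceLike.of_no_null {n : ℕ} {W : Submodule ℝ (Fin (n + 1) → ℝ)}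
    (hW : 2 ≤ Module.finrank ℝ W) (hnull : ∀ w ∈ W, lorIP w w = 0 → w = 0) : LSpaceLike W := by
  obtain ⟨⟨w, hwW⟩, hw0, hw⟩ : ∃ w : W, (w : Fin (n + 1) → ℝ) 0 = 0 ∧ w ≠ 0 := by
    have hker : LinearMap.ker ((LinearMap.proj 0 : (Fin (n + 1) → ℝ) →ₗ[ℝ] ℝ) ∘ₗ W.subtype) ≠ ⊥ :=
      LinearMap.ker_ne_bot_of_finrank_lt (by rw [Module.finrank_self]; omega)
    obtain ⟨w, hw, hne⟩ := Submodule.exists_mem_ne_zero_of_ne_bot hker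
    exact ⟨w, by simpa using hw, hne⟩
  replace hw : w ≠ 0 := fun h => hw (Subtype.ext h)
  have hwpos : 0 < lorIP w w := by
    have hnn : 0 ≤ lorIP w w := by
      rw [lorIP_eq]
      simp only at hw0
      rw [hw0]
      simpa using Finset.sum_nonneg fun i (_ : i ∈ Finset.univ) => mul_self_nonneg (w (Fin.succ i))
    exact hnn.lt_of_ne fun h => hw (hnull w hwW h.symm)
  intro u hu hu0
  by_contra hneg
  have huneg : lorIP u u < 0 :=
    lt_of_le_of_ne (not_lt.mp hneg) fun h => hu0 (hnull u hu h)
  obtain ⟨t, ht⟩ : ∃ t : ℝ, lorIP w w * (t * t) + 2 * lorIP u w * t + lorIP u u = 0 := by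
    refine exists_quadratic_eq_zero hwpos.ne'
      ⟨√(discrim (lorIP w w) (2 * lorIP u w) (lorIP u u)), ?_⟩
    refine (Real.mul_self_sqrt ?_).symm
    rw [discrim]
    nlinarith [mul_pos hwpos (neg_pos.mpr huneg), sq_nonneg (lorIP u w)]
  have hut : u + t • w = 0 := by
    refine hnull _ (W.add_mem hu (W.smul_mem t hwW)) ?_
    simp only [lorIP_add_left, lorIP_add_right, lorIP_smul_left, lorIP_smul_right, lorIP_comm w u]
    linarith
  have hue : u = (-t) • w := by
    rw [neg_smul]
    exact eq_neg_of_add_eq_zero_left hut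
  rw [hue, lorIP_smul_left, lorIP_smul_right] at huneg
  nlinarith [mul_self_nonneg t]

/-- A subspace with space-like orthogonal complement is time-like. -/
lemma LTimeLike.of_lorPerp {n : ℕ} {V : Submodule ℝ (Fin (n + 1) → ℝ)}
    (hV : LSpaceLike (lorPerp V)) : LTimeLike V := by
  have hdisj : Disjoint V (lorPerp V) := by
    rw [Submodule.disjoint_def]
    intro x hxV hx
    by_contra hne
    exact (hV x hx hne).ne' (mem_lorPerp.mp hx x hxV)
  have hcompl : IsCompl V (lorPerp V) :=
    (LinearMap.BilinForm.isCompl_orthogonal_iff_disjoint (lorForm_isSymm n).isRefl).mpr hdisj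
  obtain ⟨v, hv, w, hw, hvw⟩ := Submodule.mem_sup.mp
    (hcompl.sup_eq_top ▸ Submodule.mem_top : (Pi.single 0 1 : Fin (n + 1) → ℝ) ∈ V ⊔ lorPerp V)
  refine ⟨v, hv, ?_⟩
  have hneg : lorIP (v + w) (v + w) = -1 := by
    rw [hvw, lorIP_eq]
    simp
  have hw0 : 0 ≤ lorIP w w := by
    rcases eq_or_ne w 0 with rfl | hne
    · rw [lorIP_zero_right]
    · exact (hV w hw hne).le
  simp only [lorIP_add_left, lorIP_add_right, lorIP_comm v w, mem_lorPerp.mp hw v hv] at hneg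
  linarith

/-- A non-time-like subspace of codimension at least two has a nonzero null normal vector. -/
lemma exists_null_mem_lorPerp {n : ℕ} {V : Submodule ℝ (Fin (n + 1) → ℝ)}
    (hdim : Module.finrank ℝ V < n) (hV : ¬ LTimeLike V) :
    ∃ w ∈ lorPerp V, w ≠ 0 ∧ lorIP w w = 0 := by
  by_contra! h
  refine hV (.of_lorPerp (.of_no_null ?_ fun w hw h0 => ?_))
  · rw [finrank_lorPerp]
    omega
  · by_contra hne
    exact h w hw hne h0

/-- A space-like subspace has an orthonormal basis. -/
lemma LSpaceLike.exists_orthonormal {n : ℕ} {W : Submodule ℝ (Fin (n + 1) → ℝ)}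
    (hW : LSpaceLike W) :
    ∃ w : Fin (Module.finrank ℝ W) → Fin (n + 1) → ℝ,
      (∀ i, w i ∈ W) ∧ (∀ i i', lorIP (w i) (w i') = if i = i' then 1 else 0) ∧
      ∀ y ∈ W, (∀ i, lorIP y (w i) = 0) → y = 0 := by
  obtain ⟨v, hv⟩ := LinearMap.BilinForm.exists_orthogonal_basis
    (B := (lorForm n).restrict W) ⟨fun x y => lorIP_comm _ _⟩
  have hpos : ∀ i, 0 < lorIP (v i : Fin (n + 1) → ℝ) (v i) := fun i =>
    hW _ (v i).2 fun h => v.ne_zero i (Subtype.ext h)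
  have hsqrt : ∀ i, √(lorIP (v i : Fin (n + 1) → ℝ) (v i)) ≠ 0 := fun i =>
    (Real.sqrt_pos.mpr (hpos i)).ne'
  refine ⟨fun i => (√(lorIP (v i : Fin (n + 1) → ℝ) (v i)))⁻¹ • (v i : Fin (n + 1) → ℝ),
    fun i => W.smul_mem _ (v i).2, fun i i' => ?_, fun y hy hyv => ?_⟩
  · rw [lorIP_smul_left, lorIP_smul_right]
    split_ifs with h
    · subst h
      have := hsqrt i
      field_simp
      exact (Real.sq_sqrt (hpos i).le).symm
    · have : lorIP (v i : Fin (n + 1) → ℝ) (v i') = 0 := hv h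
      simp [this]
  · have hzero : (lorForm n y).domRestrict W = 0 := v.ext fun i => by
      have := hyv i
      rw [lorIP_smul_right] at this
      simpa [hsqrt i] using this
    by_contra hne
    exact (hW y hy hne).ne' (LinearMap.congr_fun hzero ⟨y, hy⟩)

/-- An equivalence that is smooth in both directions. -/
def IsDiffeo {a : ℕ} (e : (Fin a → ℝ) ≃ (Fin a → ℝ)) : Prop :=
  ContDiff ℝ (⊤ : ℕ∞) e ∧ ContDiff ℝ (⊤ : ℕ∞) e.symm

lemma IsDiffeo.trans {a : ℕ} {e f : (Fin a → ℝ) ≃ (Fin a → ℝ)} (he : IsDiffeo e)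
    (hf : IsDiffeo f) : IsDiffeo (e.trans f) :=
  ⟨hf.1.comp he.1, he.2.comp hf.2⟩

/-- A shear: translation by a smooth displacement that is invariant under itself. -/
lemma exists_isDiffeo_shear {a : ℕ} {g : (Fin a → ℝ) → (Fin a → ℝ)}
    (hg : ContDiff ℝ (⊤ : ℕ∞) g) (hadd : ∀ X, g (X + g X) = g X)
    (hsub : ∀ X, g (X - g X) = g X) :
    ∃ e : (Fin a → ℝ) ≃ (Fin a → ℝ), IsDiffeo e ∧ ∀ X, e X = X + g X :=
  ⟨⟨fun X => X + g X, fun X => X - g X, fun X => by simp [hadd], fun X => by simp [hsub]⟩,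
    ⟨contDiff_id.add hg, contDiff_id.sub hg⟩, fun _ => rfl⟩

lemma isDiffeo_arrowCongr {a : ℕ} (σ : Equiv.Perm (Fin a)) :
    IsDiffeo (Equiv.arrowCongr σ (Equiv.refl ℝ)) :=
  ⟨contDiff_pi.mpr fun i => contDiff_apply ℝ ℝ (σ.symm i),
    contDiff_pi.mpr fun i => contDiff_apply ℝ ℝ (σ i)⟩

lemma contDiff_lorIP_self {n : ℕ} :
    ContDiff ℝ (⊤ : ℕ∞) fun x : Fin (n + 1) → ℝ => lorIP x x := by
  unfold lorIP
  fun_prop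

lemma LinearEquiv.isDiffeo {a : ℕ} (e : (Fin a → ℝ) ≃ₗ[ℝ] (Fin a → ℝ)) : IsDiffeo e.toEquiv :=
  ⟨e.toContinuousLinearEquiv.contDiff, e.toContinuousLinearEquiv.symm.contDiff⟩

lemma isDiffeo_addLeft {a : ℕ} (c : Fin a → ℝ) : IsDiffeo (Equiv.addLeft c) :=
  ⟨contDiff_const.add contDiff_id, contDiff_const.add contDiff_id⟩

/-- The suspended normal form `τ ∘ Φ_j` of a definite fold mapping. -/
def definiteFold (j k n : ℕ) (hjn : j < n) : (Fin (n + 1) → ℝ) → (Fin (k + 1) → ℝ) :=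
  fun (x : Fin (n + 1) → ℝ) (i : Fin (k + 1)) =>
    if h : (i : ℕ) < j then x ⟨(i : ℕ) + 1, by omega⟩
    else if (i : ℕ) = j then
      x 0 ^ 2 + ∑ l : Fin (n + 1), if j + 1 ≤ (l : ℕ) then x l ^ 2 else 0
    else 0

lemma isBounded_definiteFold_fiber {j k n : ℕ} (hjn : j < n) (hjk : j < k)
    (c : Fin (k + 1) → ℝ) : Bornology.IsBounded (definiteFold j k n hjn ⁻¹' {c}) := by
  have hjc : ∀ x ∈ definiteFold j k n hjn ⁻¹' {c},
      x 0 ^ 2 + (∑ l : Fin (n + 1), if j + 1 ≤ (l : ℕ) then x l ^ 2 else 0)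
        = c ⟨j, by omega⟩ := by
    intro x hx
    simpa [definiteFold] using congrFun (Set.mem_singleton_iff.mp hx) ⟨j, by omega⟩
  have hsum : ∀ x : Fin (n + 1) → ℝ,
      0 ≤ ∑ l : Fin (n + 1), if j + 1 ≤ (l : ℕ) then x l ^ 2 else 0 := fun x =>
    Finset.sum_nonneg fun l _ => by split_ifs <;> positivity
  rw [← Bornology.forall_isBounded_image_eval_iff]
  intro l
  refine (Metric.isBounded_Icc (-(1 + |c ⟨j, by omega⟩| + ∑ i, |c i|))
    (1 + |c ⟨j, by omega⟩| + ∑ i, |c i|)).subset ?_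
  rintro _ ⟨x, hx, rfl⟩
  have hS : 0 ≤ ∑ i, |c i| := Finset.sum_nonneg fun i _ => abs_nonneg _
  rw [Set.mem_Icc, ← abs_le, Function.eval]
  have hsq : x l ^ 2 ≤ c ⟨j, by omega⟩ → |x l| ≤ 1 + |c ⟨j, by omega⟩| + ∑ i, |c i| := by
    intro h
    have h' := le_abs_self (c ⟨j, by omega⟩)
    nlinarith [sq_abs (x l), sq_nonneg (|x l| - 1), abs_nonneg (x l)]
  rcases Nat.eq_zero_or_pos (l : ℕ) with h0 | h0
  · obtain rfl : l = 0 := Fin.ext h0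
    exact hsq (by linarith [hjc x hx, hsum x])
  rcases Nat.lt_or_ge j l with hl | hl
  · refine hsq ?_
    have := Finset.single_le_sum (f := fun l : Fin (n + 1) =>
      if j + 1 ≤ (l : ℕ) then x l ^ 2 else 0) (fun l _ => by split_ifs <;> positivity)
      (Finset.mem_univ l)
    rw [if_pos (show j + 1 ≤ (l : ℕ) from hl)] at this
    nlinarith [hjc x hx, sq_nonneg (x 0)]
  · have hxl : x l = c ⟨(l : ℕ) - 1, by omega⟩ := by
      rw [← Set.mem_singleton_iff.mp hx, definiteFold, dif_pos (by simp only; omega)]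
      congr 1
      ext
      simp only
      omega
    rw [hxl]
    have := Finset.single_le_sum (f := fun i => |c i|) (fun i _ => abs_nonneg _)
      (Finset.mem_univ (⟨(l : ℕ) - 1, by omega⟩ : Fin (k + 1)))
    have := abs_nonneg (c ⟨j, by omega⟩)
    linarith

lemma sub_mem_recSub {n k : ℕ} (p : Fin (k + 1) → Fin (n + 1) → ℝ) (i : Fin (k + 1)) :
    p i - p 0 ∈ recSub p :=
  Submodule.subset_span ⟨i, rfl⟩

lemma LorDSM_add_apply {n k : ℕ} (p : Fin (k + 1) → Fin (n + 1) → ℝ) (y : Fin (n + 1) → ℝ)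
    (i : Fin (k + 1)) :
    LorDSM p (p 0 + y) i
      = lorIP y y - 2 * lorIP y (p i - p 0) + lorIP (p i - p 0) (p i - p 0) := by
  have : p 0 + y - p i = y - (p i - p 0) := by abel
  rw [LorDSM, this]
  generalize p i - p 0 = q
  rw [lorIP_sub_left, lorIP_sub_right, lorIP_sub_right, lorIP_comm q y]
  ring

/-- Along a null normal line to the recognition subspace the distance-squared mapping is
constant, so its fibers are not all compact. -/
lemma LTimeLike.of_aEquiv {j k n : ℕ} (hjn : j < n) (hjk : j < k)
    {p : Fin (k + 1) → Fin (n + 1) → ℝ} (hdim : Module.finrank ℝ (recSub p) < n)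
    (h : AEquiv (LorDSM p) (definiteFold j k n hjn)) : LTimeLike (recSub p) := by
  by_contra hV
  obtain ⟨w, hw, hw0, hnull⟩ := exists_null_mem_lorPerp hdim hV
  obtain ⟨h, H, hh, -, -, -, heq⟩ := h
  have hconst : ∀ t : ℝ, LorDSM p (p 0 + t • w) = LorDSM p (p 0) := by
    intro t
    funext i
    have h0 := LorDSM_add_apply p 0 i
    rw [add_zero] at h0
    rw [LorDSM_add_apply, h0, lorIP_comm 0 (p i - p 0)]
    simp [lorIP_smul_left, lorIP_smul_right, hnull, mem_lorPerp.mp hw _ (sub_mem_recSub p i),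
      lorIP_zero_right]
  set K := closure (definiteFold j k n hjn ⁻¹' {H (LorDSM p (p 0))})
  have hK : IsCompact K := (isBounded_definiteFold_fiber hjn hjk _).isCompact_closure
  have hbdd : Bornology.IsBounded (h '' K) := (hK.image hh.continuous).isBounded
  obtain ⟨C, hC⟩ := hbdd.exists_norm_le
  have hline : ∀ t : ℝ, ‖p 0 + t • w‖ ≤ C := fun t => by
    refine hC _ ⟨h.symm (p 0 + t • w), subset_closure ?_, by simp⟩
    simp [heq, hconst]
  have hwn : 0 < ‖w‖ := norm_pos_iff.mpr hw0
  have hC0 : 0 ≤ C := (norm_nonneg _).trans (hline 0)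
  have h1 := hline ((C + ‖p 0‖ + 1) / ‖w‖)
  have h2 := norm_le_norm_add_norm_sub' (((C + ‖p 0‖ + 1) / ‖w‖) • w)
    (p 0 + ((C + ‖p 0‖ + 1) / ‖w‖) • w)
  rw [sub_add_cancel_right, norm_neg, norm_smul, Real.norm_of_nonneg (by positivity),
    div_mul_cancel₀ _ hwn.ne'] at h2
  linarith

/-- Keep the coordinates `1, …, j` of a vector and set all others to zero. -/
def truncate {m : ℕ} (j n : ℕ) (hjm : j < m) (X : Fin m → ℝ) : Fin (n + 1) → ℝ :=
  fun l => if h : 1 ≤ (l : ℕ) ∧ (l : ℕ) ≤ j then X ⟨l, by omega⟩ else 0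

lemma contDiff_truncate {m : ℕ} (j n : ℕ) (hjm : j < m) :
    ContDiff ℝ (⊤ : ℕ∞) (truncate (m := m) j n hjm) := by
  refine contDiff_pi.mpr fun l => ?_
  unfold truncate
  split_ifs
  · exact contDiff_apply ℝ ℝ _
  · exact contDiff_const

lemma truncate_congr {m m' : ℕ} {j n : ℕ} {hjm : j < m} {hjm' : j < m'} {X : Fin m → ℝ}
    {Y : Fin m' → ℝ}
    (h : ∀ (l : ℕ) (_ : 1 ≤ l) (_ : l ≤ j), X ⟨l, by omega⟩ = Y ⟨l, by omega⟩) :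
    truncate j n hjm X = truncate j n hjm' Y := by
  funext l
  unfold truncate
  split_ifs with hl
  · exact h l hl.1 hl.2
  · rfl

/-- Linear coordinates adapted to a time-like subspace `V`: the coordinates `1, …, j` are the
products with given vectors of `V`, and the remaining ones are orthonormal on the complement. -/
lemma exists_adapted_coordinates {j n : ℕ} (hjn : j < n) {V : Submodule ℝ (Fin (n + 1) → ℝ)}
    (hV : LTimeLike V) (hdim : Module.finrank ℝ V = j) (u : Fin (n + 1) → Fin (n + 1) → ℝ)
    (hmem : ∀ l : Fin (n + 1), 1 ≤ (l : ℕ) → (l : ℕ) ≤ j → u l ∈ V)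
    (hperp : ∀ y, (∀ l : Fin (n + 1), 1 ≤ (l : ℕ) → (l : ℕ) ≤ j → lorIP y (u l) = 0) →
      y ∈ lorPerp V) :
    ∃ A : (Fin (n + 1) → ℝ) ≃ₗ[ℝ] (Fin (n + 1) → ℝ),
      (∀ y (l : Fin (n + 1)), 1 ≤ (l : ℕ) → (l : ℕ) ≤ j → A y l = lorIP y (u l)) ∧
      ∀ x, lorIP (A.symm x) (A.symm x)
        = lorIP (A.symm (truncate j n (by omega) x)) (A.symm (truncate j n (by omega) x))
          + (x 0 ^ 2 + ∑ l : Fin (n + 1), if j + 1 ≤ (l : ℕ) then x l ^ 2 else 0) := by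
  obtain ⟨v, hvV, hv⟩ := hV
  have hspace : LSpaceLike (lorPerp V) := fun w hw hw0 =>
    lorIP_self_pos_of_orthogonal hv (mem_lorPerp.mp hw v hvV) hw0
  obtain ⟨w, hwmem, hworth, hwtot⟩ := hspace.exists_orthonormal
  have hfin : Module.finrank ℝ (lorPerp V) = n + 1 - j := by rw [finrank_lorPerp, hdim]
  -- The truncated difference `l - j` enumerates the indices outside `1, …, j`.
  let idx : Fin (n + 1) → Fin (Module.finrank ℝ (lorPerp V)) := fun l => ⟨l - j, by omega⟩
  let b : Fin (n + 1) → Fin (n + 1) → ℝ := fun l =>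
    if 1 ≤ (l : ℕ) ∧ (l : ℕ) ≤ j then u l else w (idx l)
  have hb_in : ∀ l : Fin (n + 1), 1 ≤ (l : ℕ) → (l : ℕ) ≤ j → b l = u l := fun l h h' =>
    if_pos ⟨h, h'⟩
  have hb_out : ∀ l : Fin (n + 1), ¬ (1 ≤ (l : ℕ) ∧ (l : ℕ) ≤ j) → b l = w (idx l) :=
    fun l h => if_neg h
  let B : (Fin (n + 1) → ℝ) →ₗ[ℝ] (Fin (n + 1) → ℝ) :=
    LinearMap.pi fun l => (lorForm n).flip (b l)
  have hB : ∀ y l, B y l = lorIP y (b l) := fun y l => rfl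
  have hinj : Function.Injective B := by
    rw [← LinearMap.ker_eq_bot, LinearMap.ker_eq_bot']
    intro y hy
    have hyb : ∀ l, lorIP y (b l) = 0 := fun l => by rw [← hB, hy]; rfl
    refine hwtot y (hperp y fun l h h' => hb_in l h h' ▸ hyb l) fun i => ?_
    rcases Nat.eq_zero_or_pos (i : ℕ) with hi | hi
    · have := hyb 0
      rw [hb_out 0 (by simp)] at this
      convert this using 3
      ext
      simp [idx, hi]
    · have := hyb ⟨i + j, by omega⟩
      rw [hb_out _ (by simp only; omega)] at this
      convert this using 3
      ext
      simp [idx]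
  let A := LinearEquiv.ofInjectiveEndo B hinj
  have hA : ∀ y l, A y l = lorIP y (b l) := fun y l => rfl
  refine ⟨A, fun y l h h' => by rw [hA, hb_in l h h'], fun x => ?_⟩
  set y₀ := A.symm (truncate j n (by omega) x)
  let s : Finset (Fin (n + 1)) := Finset.univ.filter fun l => ¬ (1 ≤ (l : ℕ) ∧ (l : ℕ) ≤ j)
  have hs : ∀ l, l ∈ s ↔ ¬ (1 ≤ (l : ℕ) ∧ (l : ℕ) ≤ j) := fun l => by simp [s]
  set z := ∑ l ∈ s, x l • b l
  have hy₀ : ∀ l ∈ s, lorIP y₀ (b l) = 0 := fun l hl => by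
    rw [← hA, LinearEquiv.apply_symm_apply, truncate, dif_neg ((hs l).mp hl)]
  have hbb : ∀ l ∈ s, ∀ l' ∈ s, lorIP (b l) (b l') = if l = l' then 1 else 0 := by
    intro l hl l' hl'
    rw [hs] at hl hl'
    rw [hb_out l hl, hb_out l' hl', hworth]
    refine if_congr ?_ rfl rfl
    simp only [idx, Fin.ext_iff]
    omega
  have hzb : ∀ l ∈ s, lorIP z (b l) = x l := fun l hl => by
    rw [lorIP_comm, lorIP_sum_right, Finset.sum_eq_single_of_mem l hl]
    · rw [lorIP_smul_right, hbb l hl l hl, if_pos rfl, mul_one]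
    · intro l' hl' hne
      rw [lorIP_smul_right, hbb l hl l' hl', if_neg hne.symm, mul_zero]
  have hy : A.symm x = y₀ + z := by
    rw [LinearEquiv.symm_apply_eq]
    funext l
    rw [hA, lorIP_add_left]
    by_cases hl : l ∈ s
    · rw [hy₀ l hl, hzb l hl, zero_add]
    · have hl' : 1 ≤ (l : ℕ) ∧ (l : ℕ) ≤ j := by simpa [hs] using hl
      have hz0 : lorIP z (b l) = 0 := by
        rw [lorIP_comm, lorIP_sum_right]
        refine Finset.sum_eq_zero fun l₁ hl₁ => ?_
        rw [lorIP_smul_right, hb_out l₁ ((hs l₁).mp hl₁), hb_in l hl'.1 hl'.2, lorIP_comm,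
          mem_lorPerp.mp (hwmem _) _ (hmem l hl'.1 hl'.2), mul_zero]
      rw [hz0, add_zero, ← hA, LinearEquiv.apply_symm_apply, truncate, dif_pos hl']
  have hcross : lorIP y₀ z = 0 := by
    rw [lorIP_sum_right]
    exact Finset.sum_eq_zero fun l hl => by rw [lorIP_smul_right, hy₀ l hl, mul_zero]
  have hzz : lorIP z z = ∑ l ∈ s, x l ^ 2 := by
    conv_lhs => rw [lorIP_sum_right]
    exact Finset.sum_congr rfl fun l hl => by rw [lorIP_smul_right, hzb l hl, sq]
  have hsplit : ∑ l ∈ s, x l ^ 2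
      = x 0 ^ 2 + ∑ l : Fin (n + 1), if j + 1 ≤ (l : ℕ) then x l ^ 2 else 0 := by
    rw [Finset.sum_filter, Fin.sum_univ_succ, Fin.sum_univ_succ (n := n) (f := fun l =>
      if j + 1 ≤ (l : ℕ) then x l ^ 2 else 0)]
    congr 1
    rw [if_neg (by simp), zero_add]
    refine Finset.sum_congr rfl fun l _ => if_congr ?_ rfl rfl
    rw [Fin.val_succ]
    omega
  rw [hy, lorIP_add_left, lorIP_add_right, lorIP_add_right, lorIP_comm z y₀, hcross, hzz, hsplit]
  ring

lemma recSubUpTo_eq_recSub {j k n : ℕ} {p : Fin (k + 1) → Fin (n + 1) → ℝ}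
    (h : Module.finrank ℝ (recSub p) ≤ Module.finrank ℝ (recSubUpTo p j)) :
    recSubUpTo p j = recSub p :=
  Submodule.eq_of_le_of_finrank_le
    (Submodule.span_mono (by rintro _ ⟨i, _, rfl⟩; exact ⟨i, rfl⟩)) h

/-- Every difference vector is a combination of those with index in `1, …, j`. -/
lemma exists_coefficients {j k n : ℕ} {p : Fin (k + 1) → Fin (n + 1) → ℝ}
    (h : recSubUpTo p j = recSub p) (i : Fin (k + 1)) :
    ∃ r : Fin (k + 1) → ℝ, (∀ l : Fin (k + 1), ¬ (1 ≤ (l : ℕ) ∧ (l : ℕ) ≤ j) → r l = 0) ∧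
      p i - p 0 = ∑ l, r l • (p l - p 0) := by
  have hmem := h ▸ sub_mem_recSub p i
  have himg : {v | ∃ i : Fin (k + 1), (i : ℕ) ≤ j ∧ v = p i - p 0}
      = (fun i => p i - p 0) '' (Finset.univ.filter fun i : Fin (k + 1) => (i : ℕ) ≤ j) := by
    ext v
    simp [eq_comm]
  rw [recSubUpTo, himg, Submodule.mem_span_image_finset_iff_exists_fun'] at hmem
  obtain ⟨c, hc⟩ := hmem
  refine ⟨fun l => if 1 ≤ (l : ℕ) ∧ (l : ℕ) ≤ j then c l else 0, fun l hl => if_neg hl, ?_⟩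
  rw [← hc, Finset.sum_filter]
  refine Finset.sum_congr rfl fun l _ => ?_
  rcases Nat.eq_zero_or_pos (l : ℕ) with hl | hl
  · obtain rfl : l = 0 := Fin.ext hl
    simp
  · have : (1 ≤ (l : ℕ)) := hl
    simp [this, ite_smul]

lemma exists_isDiffeo_sub_zero {k : ℕ} (c : Fin (k + 1) → ℝ) :
    ∃ e : (Fin (k + 1) → ℝ) ≃ (Fin (k + 1) → ℝ), IsDiffeo e ∧
      (∀ X, e X 0 = X 0) ∧ ∀ X i, i ≠ 0 → e X i = X i - X 0 - c i := by
  obtain ⟨e, he, heX⟩ := exists_isDiffeo_shear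
    (g := fun (X : Fin (k + 1) → ℝ) i => if i = 0 then 0 else -X 0 - c i)
    (contDiff_pi.mpr fun i => by split_ifs <;> fun_prop) (fun X => by simp) (fun X => by simp)
  refine ⟨e, he, fun X => by simp [heX], fun X i hi => ?_⟩
  simp only [heX, Pi.add_apply, if_neg hi]
  ring

lemma exists_isDiffeo_sub_sum {j k : ℕ} (r : Fin (k + 1) → Fin (k + 1) → ℝ)
    (hr : ∀ i l : Fin (k + 1), ¬ (1 ≤ (l : ℕ) ∧ (l : ℕ) ≤ j) → r i l = 0) :
    ∃ e : (Fin (k + 1) → ℝ) ≃ (Fin (k + 1) → ℝ), IsDiffeo e ∧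
      ∀ X (i : Fin (k + 1)), e X i = if j < (i : ℕ) then X i - ∑ l, r i l * X l else X i := by
  have hg : ∀ X Y : Fin (k + 1) → ℝ, (∀ l : Fin (k + 1), (l : ℕ) ≤ j → X l = Y l) →
      (fun i : Fin (k + 1) => if j < (i : ℕ) then -∑ l, r i l * X l else 0)
        = fun i : Fin (k + 1) => if j < (i : ℕ) then -∑ l, r i l * Y l else 0 := by
    intro X Y h
    funext i
    congr 2
    refine Finset.sum_congr rfl fun l _ => ?_
    by_cases hl : (l : ℕ) ≤ j
    · rw [h l hl]
    · rw [hr i l (by omega), zero_mul, zero_mul]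
  obtain ⟨e, he, heX⟩ := exists_isDiffeo_shear
    (g := fun (X : Fin (k + 1) → ℝ) i => if j < (i : ℕ) then -∑ l, r i l * X l else 0)
    (contDiff_pi.mpr fun i => by split_ifs <;> fun_prop)
    (fun X => hg _ _ fun l hl => by simp [not_lt.mpr hl])
    (fun X => hg _ _ fun l hl => by simp [not_lt.mpr hl])
  refine ⟨e, he, fun X i => ?_⟩
  rw [heX]
  split_ifs with h <;> simp [h, sub_eq_add_neg]

lemma exists_isDiffeo_sub_at_zero {k : ℕ} {Q : (Fin (k + 1) → ℝ) → ℝ}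
    (hQ : ContDiff ℝ (⊤ : ℕ∞) Q) (hinv : ∀ X Y, (∀ i, i ≠ 0 → X i = Y i) → Q X = Q Y) :
    ∃ e : (Fin (k + 1) → ℝ) ≃ (Fin (k + 1) → ℝ), IsDiffeo e ∧
      (∀ X, e X 0 = X 0 - Q X) ∧ ∀ X i, i ≠ 0 → e X i = X i := by
  obtain ⟨e, he, heX⟩ := exists_isDiffeo_shear
    (g := fun (X : Fin (k + 1) → ℝ) i => if i = 0 then -Q X else 0)
    (contDiff_pi.mpr fun i => by split_ifs <;> fun_prop)
    (fun X => by
      rw [hinv _ X fun i hi => by simp [hi]])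
    (fun X => by
      rw [hinv _ X fun i hi => by simp [hi]])
  refine ⟨e, he, fun X => by simp [heX, sub_eq_add_neg], fun X i hi => by simp [heX, hi]⟩

lemma aEquiv_definiteFold {j k n : ℕ} (hjn : j < n) (hjk : j < k)
    {p : Fin (k + 1) → Fin (n + 1) → ℝ} (hspan : recSubUpTo p j = recSub p)
    (hdim : Module.finrank ℝ (recSub p) = j) (hV : LTimeLike (recSub p)) :
    AEquiv (LorDSM p) (definiteFold j k n hjn) := by
  choose r hr hrsum using exists_coefficients hspan
  let u : Fin (n + 1) → Fin (n + 1) → ℝ := fun l =>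
    if h : (l : ℕ) ≤ j then (-2 : ℝ) • (p ⟨l, by omega⟩ - p 0) else 0
  obtain ⟨A, hAu, hAsq⟩ := exists_adapted_coordinates hjn hV hdim u
    (fun l _ hl => by
      simp only [u, dif_pos hl]
      exact Submodule.smul_mem _ _ (sub_mem_recSub p _))
    (fun y hy => by
      have hi : ∀ i : Fin (k + 1), lorIP y (p i - p 0) = 0 := by
        intro i
        rw [hrsum i, lorIP_sum_right]
        refine Finset.sum_eq_zero fun l _ => ?_
        rw [lorIP_smul_right]
        by_cases hl : 1 ≤ (l : ℕ) ∧ (l : ℕ) ≤ j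
        · have := hy ⟨l, by omega⟩ hl.1 hl.2
          simp only [u, dif_pos hl.2, lorIP_smul_right] at this
          simp only [Fin.eta] at this
          rw [show lorIP y (p l - p 0) = 0 by linarith, mul_zero]
        · rw [hr i l hl, zero_mul]
      refine mem_lorPerp.mpr fun v hv => ?_
      have hle : recSub p ≤ LinearMap.ker (lorForm n y) :=
        Submodule.span_le.mpr (by rintro _ ⟨i, rfl⟩; exact hi i)
      exact hle hv)
  obtain ⟨e₁, he₁, he₁0, he₁i⟩ :=
    exists_isDiffeo_sub_zero fun i => lorIP (p i - p 0) (p i - p 0)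
  obtain ⟨e₂, he₂, he₂X⟩ := exists_isDiffeo_sub_sum r hr
  have hjk' : j < k + 1 := by omega
  obtain ⟨e₃, he₃, he₃0, he₃i⟩ := exists_isDiffeo_sub_at_zero
    (Q := fun X : Fin (k + 1) → ℝ =>
      lorIP (A.symm (truncate j n hjk' X)) (A.symm (truncate j n hjk' X)))
    (contDiff_lorIP_self.comp (A.isDiffeo.2.comp (contDiff_truncate j n hjk')))
    (fun X Y h => by
      rw [truncate_congr fun l hl _ => h ⟨l, by omega⟩ (by simp [Fin.ext_iff]; omega)])
  let σ : Equiv.Perm (Fin (k + 1)) := Fin.cycleRange ⟨j, hjk'⟩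
  have hH := ((he₁.trans he₂).trans he₃).trans (isDiffeo_arrowCongr σ.symm)
  have hh : IsDiffeo (A.symm.toEquiv.trans (Equiv.addLeft (p 0))) :=
    A.symm.isDiffeo.trans (isDiffeo_addLeft (p 0))
  refine ⟨_, _, hh.1, hh.2, hH.1, hH.2, ?_⟩
  funext x i
  set y := A.symm x
  have hx : A y = x := A.apply_symm_apply x
  change definiteFold j k n hjn x i = e₃ (e₂ (e₁ (LorDSM p (p 0 + y)))) (σ i)
  set U := e₁ (LorDSM p (p 0 + y))
  have hU0 : U 0 = lorIP y y := by
    simp [U, he₁0, LorDSM_add_apply, lorIP_zero_right]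
  have hUi : ∀ i, i ≠ 0 → U i = -2 * lorIP y (p i - p 0) := fun i hi => by
    simp only [U, he₁i _ i hi, LorDSM_add_apply, sub_self, lorIP_zero_right]
    ring
  have hUx : ∀ (l : ℕ) (_ : 1 ≤ l) (_ : l ≤ j), e₂ U ⟨l, by omega⟩ = x ⟨l, by omega⟩ := by
    intro l hl hlj
    rw [he₂X, if_neg (by simpa using hlj), hUi _ (by simp [Fin.ext_iff]; omega), ← hx,
      hAu y ⟨l, by omega⟩ hl hlj]
    simp only [u, dif_pos hlj, lorIP_smul_right]
  have hUgt : ∀ i : Fin (k + 1), j < (i : ℕ) → e₂ U i = 0 := by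
    intro i hi
    have hi0 : i ≠ 0 := by
      rintro rfl
      simp at hi
    rw [he₂X, if_pos hi, hUi i hi0, hrsum i, lorIP_sum_right, Finset.mul_sum,
      ← Finset.sum_sub_distrib]
    refine Finset.sum_eq_zero fun l _ => ?_
    rw [lorIP_smul_right]
    by_cases hl : 1 ≤ (l : ℕ) ∧ (l : ℕ) ≤ j
    · rw [hUi l (by rintro rfl; simp at hl)]
      ring
    · rw [hr i l hl]
      ring
  rcases lt_trichotomy (i : ℕ) j with hi | hi | hi
  · have hσ : σ i = ⟨i + 1, by omega⟩ :=
      Fin.ext (Fin.coe_cycleRange_of_lt (show i < ⟨j, hjk'⟩ from hi))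
    rw [hσ, he₃i _ _ (Fin.ne_of_val_ne (Nat.succ_ne_zero _)), hUx _ (by omega) hi,
      definiteFold, dif_pos hi]
  · have hσ : σ i = 0 := Fin.cycleRange_of_eq (Fin.ext hi)
    rw [hσ, he₃0, he₂X, if_neg (by simp), hU0, truncate_congr (hjm' := by omega) hUx, hAsq x,
      definiteFold, dif_neg hi.not_lt, if_pos hi]
    ring
  · have hσ : σ i = i := Fin.cycleRange_of_gt (show ⟨j, hjk'⟩ < i from hi)
    rw [hσ, he₃i _ _ (by rintro rfl; simp at hi), hUgt i hi, definiteFold,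
      dif_neg (by omega), if_neg (by omega)]

theorem theorem4_1a (j k n : ℕ) (hj : 1 ≤ j) (hjn : j < n) (hjk : j < k)
    (p : Fin (k + 1) → Fin (n + 1) → ℝ)
    (h1 : Module.finrank ℝ (recSubUpTo p j) = j)
    (h2 : Module.finrank ℝ (recSub p) = j) :
    AEquiv (LorDSM p)
        (fun (x : Fin (n + 1) → ℝ) (i : Fin (k + 1)) =>
          if h : (i : ℕ) < j then x ⟨(i : ℕ) + 1, by omega⟩
          else if (i : ℕ) = j then
            x 0 ^ 2 + ∑ l : Fin (n + 1), if j + 1 ≤ (l : ℕ) then x l ^ 2 else 0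
          else 0)
      ↔ LTimeLike (recSub p) := by
  exact ⟨fun h => .of_aEquiv hjn hjk (h2.trans_lt hjn) h,
    aEquiv_definiteFold hjn hjk (recSubUpTo_eq_recSub (h2.trans h1.symm).le) h2⟩
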